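/- Let φ : GL_n(F) → ℂ be a function for which there exists an integer n₀ ≥ 1 with φ(k₁·g·k₂) = φ(g) for all g ∈ GL_n(F) and all k₁, k₂ ∈ K_{n₀} (such φ is in particular locally constant). Then for any open compact subset 𝔫 of Fˣ, there exists an integer ℓ_𝔫 such that for all integers ℓ, m > ℓ_𝔫 and all x ∈ 𝔫: ∫_{det g = x} (Φ_GJ * c_ℓ^∨)(g)·φ(g) d_xg = ∫_{det g = x} (Φ_GJ * c_m^∨)(g)·φ(g) d_xg; that is, the truncated fiber integrals are uniformly stable as ℓ → ∞ for x ranging in 𝔫. -/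

import Mathlib

open MeasureTheory Matrix

/-- `M_n(𝔭^k)`: matrices over `F` with all entries in `𝔭^k` (norm at most `‖ϖ‖^k`). -/
def MnP (n : ℕ) {F : Type*} [NontriviallyNormedField F] (ϖ : F) (k : ℤ) :
    Set (Matrix (Fin n) (Fin n) F) :=
  {g | ∀ i j, ‖g i j‖ ≤ ‖ϖ‖ ^ k}

/-- The principal congruence subgroup `K_ℓ = I_n + M_n(𝔭^ℓ)`, as a set of matrices. -/
def Kcong (n : ℕ) {F : Type*} [NontriviallyNormedField F] (ϖ : F) (ℓ : ℤ) :
    Set (Matrix (Fin n) (Fin n) F) :=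
  {g | ∀ i j, ‖g i j - (1 : Matrix (Fin n) (Fin n) F) i j‖ ≤ ‖ϖ‖ ^ ℓ}

/-- The Haar measure `dg = d⁺g / |det g|^n` on `GL_n(F)`, obtained from the additive Haar
measure `μp` on `M_n(F)` by the density `|det g|_F^{-n}`. -/
noncomputable def muGL (n : ℕ) {F : Type*} [NontriviallyNormedField F]
    [MeasurableSpace (Matrix (Fin n) (Fin n) F)]
    (μp : Measure (Matrix (Fin n) (Fin n) F)) : Measure (Matrix (Fin n) (Fin n) F) :=
  μp.withDensity fun g => ENNReal.ofReal ((‖g.det‖ ^ n)⁻¹)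

/-- `c_ℓ = vol(K_ℓ)⁻¹ · 1_{K_ℓ}`, the characteristic function of the principal congruence
subgroup `K_ℓ` normalized by its volume for the Haar measure of `GL_n(F)`. -/
noncomputable def cFun (n : ℕ) {F : Type*} [NontriviallyNormedField F]
    [MeasurableSpace (Matrix (Fin n) (Fin n) F)]
    (μp : Measure (Matrix (Fin n) (Fin n) F)) (ϖ : F) (ℓ : ℤ) :
    Matrix (Fin n) (Fin n) F → ℂ :=
  (Kcong n ϖ ℓ).indicator fun _ => (((muGL n μp (Kcong n ϖ ℓ)).toReal : ℂ))⁻¹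

/-- The Godement–Jacquet kernel `Φ_GJ(g) = ψ(tr g)·|det g|_F^{n/2}`. -/
noncomputable def PhiGJ (n : ℕ) {F : Type*} [NontriviallyNormedField F] (ψ : F → ℂ) :
    Matrix (Fin n) (Fin n) F → ℂ :=
  fun g => ψ g.trace * ((‖g.det‖ ^ ((n : ℝ) / 2) : ℝ) : ℂ)

/-- The convolution `(Φ_GJ * ξ^∨)(g) = ∫_{GL_n(F)} Φ_GJ(h)·ξ(g⁻¹h) dh`, the integral being
taken with respect to the Haar measure of `GL_n(F)`. -/
noncomputable def convGJ (n : ℕ) {F : Type*} [NontriviallyNormedField F]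
    [MeasurableSpace (Matrix (Fin n) (Fin n) F)]
    (μp : Measure (Matrix (Fin n) (Fin n) F)) (ψ : F → ℂ)
    (ξ : Matrix (Fin n) (Fin n) F → ℂ) (g : Matrix (Fin n) (Fin n) F) : ℂ :=
  ∫ h, PhiGJ n ψ h * ξ (g⁻¹ * h) ∂(muGL n μp)

/-- `t₁(x) = diag(x, 1, …, 1)`, a section of the determinant map. -/
noncomputable def t1 (n : ℕ) {F : Type*} [NontriviallyNormedField F] (x : F) :
    Matrix (Fin n) (Fin n) F :=
  Matrix.diagonal fun i => if (i : ℕ) = 0 then x else 1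

section Ultrametric

variable {F : Type*} [NontriviallyNormedField F] [IsUltrametricDist F] {n : ℕ}

theorem norm_dotProduct_le_of_le {v w : Fin n → F} {a b : ℝ} (hb : 0 ≤ b) (ha : 0 ≤ a)
    (hv : ∀ i, ‖v i‖ ≤ a) (hw : ∀ i, ‖w i‖ ≤ b) : ‖v ⬝ᵥ w‖ ≤ a * b := by
  refine IsUltrametricDist.norm_sum_le_of_forall_le_of_nonneg (by positivity) fun i _ => ?_
  rw [norm_mul]
  exact mul_le_mul (hv i) (hw i) (norm_nonneg _) ha

theorem norm_mul_apply_le_of_le {A B : Matrix (Fin n) (Fin n) F} {a b : ℝ} (hb : 0 ≤ b)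
    (ha : 0 ≤ a) (hA : ∀ i j, ‖A i j‖ ≤ a) (hB : ∀ i j, ‖B i j‖ ≤ b) (i j : Fin n) :
    ‖(A * B) i j‖ ≤ a * b :=
  norm_dotProduct_le_of_le hb ha (hA i) fun k => hB k j

theorem norm_trace_le_of_le {A : Matrix (Fin n) (Fin n) F} {a : ℝ} (ha : 0 ≤ a)
    (hA : ∀ i j, ‖A i j‖ ≤ a) : ‖A.trace‖ ≤ a :=
  IsUltrametricDist.norm_sum_le_of_forall_le_of_nonneg ha fun i _ => hA i i

theorem norm_dotProduct_mulVec_le {v w : Fin n → F} {A : Matrix (Fin n) (Fin n) F} {a : ℝ}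
    (ha : 0 ≤ a) (hv : ∀ i, ‖v i‖ ≤ 1) (hw : ∀ i, ‖w i‖ ≤ 1) (hA : ∀ i j, ‖A i j‖ ≤ a) :
    ‖w ⬝ᵥ (A *ᵥ v)‖ ≤ a := by
  have h : ∀ i, ‖(A *ᵥ v) i‖ ≤ a := fun i => by
    simpa [mulVec] using norm_dotProduct_le_of_le zero_le_one ha (hA i) hv
  simpa using norm_dotProduct_le_of_le ha zero_le_one hw h

/-- A matrix whose diagonal entries have norm `R` and whose off-diagonal entries are smaller
has determinant of norm `R ^ n`. -/
theorem norm_det_eq_pow_of_offDiag_lt {A : Matrix (Fin n) (Fin n) F} {R : ℝ} (hR : 0 < R)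
    (hd : ∀ i, ‖A i i‖ = R) (ho : ∀ i j, i ≠ j → ‖A i j‖ < R) : ‖A.det‖ = R ^ n := by
  classical
  have hle : ∀ i j, ‖A i j‖ ≤ R := fun i j => by
    by_cases h : i = j
    · subst h; exact (hd i).le
    · exact (ho i j h).le
  have hone : ‖∏ i, A i i‖ = R ^ n := by
    rw [norm_prod]; simp [hd]
  rw [Matrix.det_apply, ← Finset.add_sum_erase _ _ (Finset.mem_univ (1 : Equiv.Perm (Fin n)))]
  simp only [Equiv.Perm.sign_one, one_smul, Equiv.Perm.coe_one, id]
  have hlt : ‖∑ σ ∈ Finset.univ.erase (1 : Equiv.Perm (Fin n)),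
      Equiv.Perm.sign σ • ∏ i, A (σ i) i‖ < R ^ n := by
    by_cases hne : (Finset.univ.erase (1 : Equiv.Perm (Fin n))).Nonempty
    · obtain ⟨σ, hσ, hs⟩ := IsUltrametricDist.exists_norm_finsetSum_le_of_nonempty hne
        (fun σ => Equiv.Perm.sign σ • ∏ i, A (σ i) i)
      refine hs.trans_lt ?_
      have hsgn : ‖Equiv.Perm.sign σ • ∏ i, A (σ i) i‖ = ∏ i, ‖A (σ i) i‖ := by
        rw [← norm_prod]
        rcases Int.units_eq_one_or (Equiv.Perm.sign σ) with h | h <;> simp [h]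
      rw [hsgn]
      obtain ⟨i, hi⟩ : ∃ i, σ i ≠ i := by
        by_contra! h
        exact (Finset.mem_erase.1 hσ).1 (Equiv.ext h)
      rw [← Finset.mul_prod_erase _ _ (Finset.mem_univ i)]
      have hn : R ^ n = R * ∏ _j ∈ Finset.univ.erase i, R := by
        rw [Finset.mul_prod_erase _ (fun _ => R) (Finset.mem_univ i)]; simp
      rw [hn]
      calc ‖A (σ i) i‖ * ∏ j ∈ Finset.univ.erase i, ‖A (σ j) j‖
          ≤ ‖A (σ i) i‖ * ∏ _j ∈ Finset.univ.erase i, R := by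
            gcongr with j
            exact hle _ _
        _ < R * ∏ _j ∈ Finset.univ.erase i, R :=
            mul_lt_mul_of_pos_right (ho _ _ hi) (Finset.prod_pos fun _ _ => hR)
    · rw [Finset.not_nonempty_iff_eq_empty.1 hne]; simp; positivity
  rw [IsUltrametricDist.norm_add_eq_max_of_norm_ne_norm (by rw [hone]; exact hlt.ne'), hone,
    max_eq_left hlt.le]

end Ultrametric

section Unipotent

variable {F : Type*} [NontriviallyNormedField F] {n : ℕ}

/-- The one-parameter family `1 + s • v wᵀ`, unipotent when `wᵀ v = 0`. -/
def unip (v w : Fin n → F) (s : F) : Matrix (Fin n) (Fin n) F := 1 + s • vecMulVec v w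

theorem unip_mul (v w : Fin n → F) (s : F) (g : Matrix (Fin n) (Fin n) F) :
    unip v w s * g = g + s • vecMulVec v w * g := by
  rw [unip, add_mul, one_mul]

theorem unip_neg_mul_unip {v w : Fin n → F} (h : w ⬝ᵥ v = 0) (s : F) :
    unip v w (-s) * unip v w s = 1 := by
  rw [unip_mul]
  simp [unip, mul_add, vecMulVec_mul_vecMulVec, h]

theorem det_unip {v w : Fin n → F} (h : w ⬝ᵥ v = 0) (s : F) : (unip v w s).det = 1 := by
  have h1 : vecMulVec (s • v) w = replicateCol Unit (s • v) * replicateRow Unit w := by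
    rw [vecMulVec_eq Unit]
  rw [unip, ← smul_vecMulVec, h1, det_one_add_replicateCol_mul_replicateRow]
  simp [h]

theorem trace_unip_mul (v w : Fin n → F) (s : F) (g : Matrix (Fin n) (Fin n) F) :
    (unip v w s * g).trace = g.trace + s * (w ⬝ᵥ (g *ᵥ v)) := by
  rw [unip_mul, trace_add, smul_mul_assoc, trace_smul, vecMulVec_mul, trace_vecMulVec,
    dotProduct_comm, ← dotProduct_mulVec, smul_eq_mul]

theorem dotProduct_unip_mul_mulVec {v w : Fin n → F} (h : w ⬝ᵥ v = 0) (s : F)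
    (g : Matrix (Fin n) (Fin n) F) :
    w ⬝ᵥ ((unip v w s * g) *ᵥ v) = w ⬝ᵥ (g *ᵥ v) := by
  rw [unip_mul, add_mulVec, dotProduct_add, smul_mul_assoc, smul_mulVec, vecMulVec_mul,
    vecMulVec_mulVec]
  simp [h]

end Unipotent

section Averaging

theorem integral_indicator_eq_zero_of_add_left {A : Type*} [AddGroup A] [MeasurableSpace A]
    [MeasurableAdd A] (μ : Measure A) [μ.IsAddLeftInvariant] {B : Set A} {χ : A → ℂ} {a₀ : A}
    {c : ℂ} (hc : c ≠ 1) (hB : ∀ a, a₀ + a ∈ B ↔ a ∈ B)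
    (hχ : ∀ a ∈ B, χ (a₀ + a) = c * χ a) : ∫ a, B.indicator χ a ∂μ = 0 := by
  have h : ∫ a, B.indicator χ a ∂μ = c * ∫ a, B.indicator χ a ∂μ := by
    rw [← integral_const_mul]
    conv_lhs => rw [← integral_add_left_eq_self _ a₀]
    congr 1 with a
    by_cases ha : a ∈ B
    · rw [Set.indicator_of_mem ((hB a).2 ha), Set.indicator_of_mem ha, hχ a ha]
    · rw [Set.indicator_of_notMem (mt (hB a).1 ha), Set.indicator_of_notMem ha, mul_zero]
  by_contra h0
  exact hc (mul_right_cancel₀ h0 (by rw [one_mul, ← h]))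

/-- If the integral of `f` is unchanged on multiplying `f` by `χ s` for almost every `s`, and
the average of `χ · a` vanishes wherever `f a ≠ 0`, then the integral of `f` vanishes. -/
theorem integral_eq_zero_of_average {α β : Type*} [MeasurableSpace α] [MeasurableSpace β]
    (ν : Measure α) [SFinite ν] (η : Measure β) [IsFiniteMeasure η] (hη : η ≠ 0)
    {f : α → ℂ} (hf : Integrable f ν) {χ : β → α → ℂ}
    (hχm : Measurable (Function.uncurry χ)) (hχ1 : ∀ s a, ‖χ s a‖ ≤ 1)
    (hinv : ∀ᵐ s ∂η, ∫ a, χ s a * f a ∂ν = ∫ a, f a ∂ν)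
    (havg : ∀ a, f a ≠ 0 → ∫ s, χ s a ∂η = 0) : ∫ a, f a ∂ν = 0 := by
  have hfi : Integrable (Function.uncurry fun s a => χ s a * f a) (η.prod ν) :=
    (hf.comp_snd η).bdd_mul (c := 1) hχm.aestronglyMeasurable (.of_forall fun p => hχ1 p.1 p.2)
  have h1 := integral_integral_swap hfi
  rw [integral_congr_ae hinv, integral_const] at h1
  have h2 : ∀ a, ∫ s, χ s a * f a ∂η = 0 := fun a => by
    rw [integral_mul_const]
    by_cases ha : f a = 0
    · rw [ha, mul_zero]
    · rw [havg a ha, zero_mul]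
  simp only [h2, integral_zero, smul_eq_zero] at h1
  refine h1.resolve_left fun h => hη ?_
  simpa [Measure.real, ENNReal.toReal_eq_zero_iff] using h

end Averaging

section AdditiveCharacter

variable {F : Type*} [NontriviallyNormedField F] {ψ : F → ℂ}

theorem norm_addChar_le_one [ProperSpace F] [IsUltrametricDist F] (hψc : Continuous ψ)
    (hψadd : ∀ x y : F, ψ (x + y) = ψ x * ψ y) (hψ0 : ψ 0 = 1) (y : F) : ‖ψ y‖ ≤ 1 := by
  by_contra! h
  obtain ⟨C, hC⟩ := (isCompact_closedBall (0 : F) ‖y‖).exists_bound_of_continuousOn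
    hψc.continuousOn
  have hpow : ∀ k : ℕ, ψ (k * y) = ψ y ^ k := fun k => by
    induction k with
    | zero => simp [hψ0]
    | succ k ih => rw [Nat.cast_succ, add_mul, one_mul, hψadd, ih, pow_succ]
  obtain ⟨k, hk⟩ := pow_unbounded_of_one_lt C h
  have hky : ‖(k : F) * y‖ ≤ ‖y‖ := by
    rw [norm_mul]
    exact mul_le_of_le_one_left (norm_nonneg _) (IsUltrametricDist.norm_natCast_le_one F k)
  have := hC (k * y) (by simpa using hky)
  rw [hpow, norm_pow] at this
  linarith

theorem add_mem_iff_of_norm_le [IsUltrametricDist F] {a₀ : F} {ρ : ℝ} (h : ‖a₀‖ ≤ ρ) (a : F) :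
    ‖a₀ + a‖ ≤ ρ ↔ ‖a‖ ≤ ρ := by
  refine ⟨fun h' => ?_, fun h' => (IsUltrametricDist.norm_add_le_max _ _).trans (max_le h h')⟩
  rw [← neg_add_cancel_left a₀ a]
  exact (IsUltrametricDist.norm_add_le_max _ _).trans (max_le (by rwa [norm_neg]) h')

theorem integral_ball_addChar_mul_eq_zero [IsUltrametricDist F] [MeasurableSpace F]
    [BorelSpace F] (μ : Measure F) [μ.IsAddLeftInvariant]
    (hψadd : ∀ x y : F, ψ (x + y) = ψ x * ψ y)
    {q ρ R : ℝ} (hR : 0 < R) (hρ : q ≤ ρ * R) (hψ : ∃ z : F, ‖z‖ ≤ q ∧ ψ z ≠ 1)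
    {y : F} (hy : R ≤ ‖y‖) :
    ∫ s in Metric.closedBall (0 : F) ρ, ψ (s * y) ∂μ = 0 := by
  obtain ⟨z, hz, hz1⟩ := hψ
  have hy0 : 0 < ‖y‖ := hR.trans_le hy
  have hs : ‖z / y‖ ≤ ρ := by
    rw [norm_div, div_le_iff₀ hy0]
    rcases le_or_gt 0 ρ with h | h
    · exact hz.trans (hρ.trans (by gcongr))
    · nlinarith [norm_nonneg z]
  rw [← integral_indicator Metric.isClosed_closedBall.measurableSet]
  refine integral_indicator_eq_zero_of_add_left μ (a₀ := z / y) hz1 (fun a => ?_) fun a _ => ?_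
  · simpa using add_mem_iff_of_norm_le hs a
  · rw [add_mul, div_mul_cancel₀ _ (norm_pos_iff.1 hy0), hψadd]

end AdditiveCharacter

section MatrixSpace

variable {F : Type*} [NontriviallyNormedField F] {n : ℕ}

instance [ProperSpace F] : SecondCountableTopology (Matrix (Fin n) (Fin n) F) :=
  haveI := secondCountable_of_proper (α := F)
  inferInstanceAs (SecondCountableTopology (Fin n → Fin n → F))

instance [ProperSpace F] : LocallyCompactSpace (Matrix (Fin n) (Fin n) F) :=
  inferInstanceAs (LocallyCompactSpace (Fin n → Fin n → F))

/-- Left multiplication by an invertible matrix. -/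
noncomputable def mulLeftEquiv (g : Matrix (Fin n) (Fin n) F) (hg : g.det ≠ 0) :
    Matrix (Fin n) (Fin n) F ≃ₜ+ Matrix (Fin n) (Fin n) F where
  toFun h := g * h
  invFun h := g⁻¹ * h
  left_inv h := nonsing_inv_mul_cancel_left _ _ hg.isUnit
  right_inv h := mul_nonsing_inv_cancel_left _ _ hg.isUnit
  map_add' := mul_add g
  continuous_toFun := by fun_prop
  continuous_invFun := by fun_prop

theorem continuous_dotProduct_mulVec (v w : Fin n → F) :
    Continuous fun g : Matrix (Fin n) (Fin n) F => w ⬝ᵥ (g *ᵥ v) := by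
  fun_prop

variable [MeasurableSpace (Matrix (Fin n) (Fin n) F)] [BorelSpace (Matrix (Fin n) (Fin n) F)]

theorem measurableEmbedding_mul_left {g : Matrix (Fin n) (Fin n) F} (hg : g.det ≠ 0) :
    MeasurableEmbedding fun h => g * h :=
  (mulLeftEquiv g hg).toHomeomorph.measurableEmbedding

theorem exists_map_mul_left_eq_smul [ProperSpace F] (μ : Measure (Matrix (Fin n) (Fin n) F))
    [μ.IsAddHaarMeasure] {g : Matrix (Fin n) (Fin n) F} (hg : g.det ≠ 0) :
    ∃ c : NNReal, c ≠ 0 ∧ μ.map (fun h => g * h) = c • μ := by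
  have : (μ.map (mulLeftEquiv g hg)).IsAddHaarMeasure :=
    ContinuousAddEquiv.isAddHaarMeasure_map μ _
  exact ⟨_, (Measure.addHaarScalarFactor_pos_of_isAddHaarMeasure _ μ).ne',
    Measure.isAddLeftInvariant_eq_smul (μ.map (mulLeftEquiv g hg)) μ⟩

end MatrixSpace

section UnipotentAverage

variable {F : Type*} [NontriviallyNormedField F] [ProperSpace F] [IsUltrametricDist F]
  [MeasurableSpace F] [BorelSpace F] {n : ℕ}
  [MeasurableSpace (Matrix (Fin n) (Fin n) F)] [BorelSpace (Matrix (Fin n) (Fin n) F)]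

theorem integral_indicator_eq_zero_of_unip {ψ : F → ℂ} (hψc : Continuous ψ)
    (hψadd : ∀ x y : F, ψ (x + y) = ψ x * ψ y) (hψ0 : ψ 0 = 1)
    {q ρ R : ℝ} (hR : 0 < R) (hρ0 : 0 < ρ) (hρ : q ≤ ρ * R)
    (hψ : ∃ z : F, ‖z‖ ≤ q ∧ ψ z ≠ 1)
    (ν : Measure (Matrix (Fin n) (Fin n) F)) [SFinite ν]
    (hν : ∀ s : Matrix (Fin n) (Fin n) F, s.det = 1 → ν.map (fun h => s * h) = ν)
    {v w : Fin n → F} (hvw : w ⬝ᵥ v = 0) {S : Set (Matrix (Fin n) (Fin n) F)}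
    {f : Matrix (Fin n) (Fin n) F → ℂ} (hf : Integrable (S.indicator f) ν)
    (hS : ∀ s : F, ‖s‖ ≤ ρ → ∀ g ∈ S, unip v w s * g ∈ S)
    (hfS : ∀ s : F, ‖s‖ ≤ ρ → ∀ g ∈ S, f (unip v w s * g) = ψ (s * (w ⬝ᵥ (g *ᵥ v))) * f g)
    (hL : ∀ g ∈ S, R ≤ ‖w ⬝ᵥ (g *ᵥ v)‖) :
    ∫ g, S.indicator f g ∂ν = 0 := by
  have := secondCountable_of_proper (α := F)
  let μ : Measure F := Measure.addHaar
  let B := Metric.closedBall (0 : F) ρ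
  have hBfin : IsFiniteMeasure (μ.restrict B) :=
    ⟨by rw [Measure.restrict_apply_univ]; exact (isCompact_closedBall _ _).measure_lt_top⟩
  refine integral_eq_zero_of_average ν (μ.restrict B) ?_ hf
    (χ := fun s g => ψ (s * (w ⬝ᵥ (g *ᵥ v)))) ?_ (fun _ _ => norm_addChar_le_one hψc hψadd hψ0 _)
    ?_ ?_
  · rw [Ne, Measure.restrict_eq_zero]
    exact (Metric.measure_closedBall_pos μ _ hρ0).ne'
  · exact hψc.measurable.comp (measurable_fst.mul
      ((continuous_dotProduct_mulVec v w).measurable.comp measurable_snd))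
  · refine ae_restrict_of_forall_mem Metric.isClosed_closedBall.measurableSet fun s hs => ?_
    replace hs : ‖s‖ ≤ ρ := by simpa using hs
    have hdet := det_unip hvw s
    conv_rhs => rw [← hν _ hdet,
      (measurableEmbedding_mul_left (by rw [hdet]; exact one_ne_zero)).integral_map]
    congr 1 with g
    by_cases hg : g ∈ S
    · rw [Set.indicator_of_mem hg, Set.indicator_of_mem (hS s hs g hg), hfS s hs g hg]
    · rw [Set.indicator_of_notMem hg, Set.indicator_of_notMem, mul_zero]
      intro h
      refine hg ?_
      have := hS (-s) (by rwa [norm_neg]) _ h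
      rwa [← mul_assoc, unip_neg_mul_unip hvw, one_mul] at this
  · intro g hg
    exact integral_ball_addChar_mul_eq_zero μ hψadd hR hρ hψ
      (hL g (Set.mem_of_indicator_ne_zero hg))

end UnipotentAverage

section Lattice

variable {F : Type*} [NontriviallyNormedField F] {n : ℕ} {ϖ : F}

theorem MnP_eq_pi (k : ℤ) : MnP n ϖ k = Set.pi Set.univ fun _ : Fin n =>
    Set.pi Set.univ fun _ : Fin n => Metric.closedBall (0 : F) (‖ϖ‖ ^ k) := by
  ext g
  change _ ↔ ∀ i ∈ Set.univ, ∀ j ∈ Set.univ, g i j ∈ Metric.closedBall (0 : F) (‖ϖ‖ ^ k)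
  simp [MnP]

theorem isCompact_MnP [ProperSpace F] (k : ℤ) : IsCompact (MnP n ϖ k) := by
  rw [MnP_eq_pi]
  exact isCompact_univ_pi fun _ => isCompact_univ_pi fun _ => isCompact_closedBall _ _

theorem isOpen_MnP [IsUltrametricDist F] (hϖ0 : 0 < ‖ϖ‖) (k : ℤ) : IsOpen (MnP n ϖ k) := by
  rw [MnP_eq_pi]
  exact isOpen_set_pi Set.finite_univ fun _ _ => isOpen_set_pi Set.finite_univ fun _ _ =>
    IsUltrametricDist.isOpen_closedBall _ (zpow_pos hϖ0 k).ne'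

theorem MnP_subset_MnP (hϖ0 : 0 < ‖ϖ‖) (hϖ1 : ‖ϖ‖ < 1) {k l : ℤ} (h : k ≤ l) :
    MnP n ϖ l ⊆ MnP n ϖ k := fun _ hg i j =>
  (hg i j).trans (zpow_le_zpow_right_of_le_one₀ hϖ0 hϖ1.le h)

theorem add_mem_MnP [IsUltrametricDist F] {k : ℤ} {g h : Matrix (Fin n) (Fin n) F}
    (hg : g ∈ MnP n ϖ k) (hh : h ∈ MnP n ϖ k) : g + h ∈ MnP n ϖ k := fun i j =>
  (IsUltrametricDist.norm_add_le_max _ _).trans (max_le (hg i j) (hh i j))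

theorem neg_mem_MnP {k : ℤ} {g : Matrix (Fin n) (Fin n) F}
    (hg : g ∈ MnP n ϖ k) : -g ∈ MnP n ϖ k := fun i j => by
  rw [Matrix.neg_apply, norm_neg]; exact hg i j

theorem add_mem_MnP_iff [IsUltrametricDist F] {k : ℤ} {g h : Matrix (Fin n) (Fin n) F}
    (hh : h ∈ MnP n ϖ k) : g + h ∈ MnP n ϖ k ↔ g ∈ MnP n ϖ k :=
  ⟨fun H => by simpa using add_mem_MnP H (neg_mem_MnP hh), fun H => add_mem_MnP H hh⟩

theorem mul_mem_MnP [IsUltrametricDist F] (hϖ0 : 0 < ‖ϖ‖) {k l : ℤ}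
    {g h : Matrix (Fin n) (Fin n) F} (hg : g ∈ MnP n ϖ k) (hh : h ∈ MnP n ϖ l) :
    g * h ∈ MnP n ϖ (k + l) := fun i j => by
  rw [zpow_add₀ hϖ0.ne']
  exact norm_mul_apply_le_of_le (zpow_nonneg hϖ0.le l) (zpow_nonneg hϖ0.le k) hg hh i j

theorem mem_Kcong_iff {k : ℤ} {g : Matrix (Fin n) (Fin n) F} :
    g ∈ Kcong n ϖ k ↔ g - 1 ∈ MnP n ϖ k := Iff.rfl

theorem isOpen_Kcong [IsUltrametricDist F] (hϖ0 : 0 < ‖ϖ‖) (k : ℤ) : IsOpen (Kcong n ϖ k) :=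
  (isOpen_MnP hϖ0 k).preimage (continuous_id.sub continuous_const)

theorem one_mem_Kcong (hϖ0 : 0 < ‖ϖ‖) (k : ℤ) :
    (1 : Matrix (Fin n) (Fin n) F) ∈ Kcong n ϖ k := fun i j => by
  simpa using zpow_nonneg hϖ0.le k

theorem norm_det_of_mem_Kcong [IsUltrametricDist F] (hϖ0 : 0 < ‖ϖ‖) (hϖ1 : ‖ϖ‖ < 1) {k : ℤ}
    (hk : 1 ≤ k) {g : Matrix (Fin n) (Fin n) F} (hg : g ∈ Kcong n ϖ k) : ‖g.det‖ = 1 := by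
  have hlt : ‖ϖ‖ ^ k < 1 := by
    simpa using zpow_lt_zpow_right_of_lt_one₀ hϖ0 hϖ1 (show (0 : ℤ) < k by lia)
  have h := norm_det_eq_pow_of_offDiag_lt (A := g) one_pos (fun i => ?_) fun i j hij => ?_
  · simpa using h
  · have h1 := (hg i i).trans_lt hlt
    rw [one_apply_eq] at h1
    have h2 := IsUltrametricDist.norm_add_eq_max_of_norm_ne_norm (x := g i i - 1) (y := 1)
      (by rw [norm_one]; exact h1.ne)
    rwa [sub_add_cancel, norm_one, max_eq_right h1.le] at h2
  · have h1 := (hg i j).trans_lt hlt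
    rwa [one_apply_ne hij, sub_zero] at h1

theorem zpow_pred_le_norm_of_zpow_lt (hϖ0 : 0 < ‖ϖ‖) (hϖ1 : ‖ϖ‖ < 1)
    (hdisc : ∀ x : F, x ≠ 0 → ∃ k : ℤ, ‖x‖ = ‖ϖ‖ ^ k) {k : ℤ} {x : F}
    (h : ‖ϖ‖ ^ k < ‖x‖) : ‖ϖ‖ ^ (k - 1) ≤ ‖x‖ := by
  obtain ⟨j, hj⟩ := hdisc x (norm_pos_iff.1 ((zpow_pos hϖ0 k).trans h))
  rw [hj] at h ⊢
  have := (zpow_lt_zpow_iff_right_of_lt_one₀ hϖ0 hϖ1).1 h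
  exact zpow_le_zpow_right_of_le_one₀ hϖ0 hϖ1.le (by lia)

end Lattice

section OrthogonalPairs

variable {F : Type*} [NontriviallyNormedField F] {n : ℕ}

open scoped Classical in
/-- The pairs `(e_j, e_i)` and `(e_i + e_j, e_i - e_j)` for `i ≠ j`. -/
noncomputable def orthPairs (n : ℕ) (F : Type*) [NontriviallyNormedField F] :
    Finset ((Fin n → F) × (Fin n → F)) :=
  (Finset.univ.offDiag.image fun p => (Pi.single p.2 1, Pi.single p.1 1)) ∪
    Finset.univ.offDiag.image fun p =>
      (Pi.single p.1 1 + Pi.single p.2 1, Pi.single p.1 1 - Pi.single p.2 1)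

theorem dotProduct_eq_zero_of_mem_orthPairs {p : (Fin n → F) × (Fin n → F)}
    (hp : p ∈ orthPairs n F) : p.2 ⬝ᵥ p.1 = 0 := by
  simp only [orthPairs, Finset.mem_union, Finset.mem_image, Finset.mem_offDiag] at hp
  obtain ⟨⟨i, j⟩, ⟨-, -, hij⟩, rfl⟩ | ⟨⟨i, j⟩, ⟨-, -, hij⟩, rfl⟩ := hp
  · simp [hij]
  · have h1 : (Pi.single i 1 : Fin n → F) j = 0 := Pi.single_eq_of_ne hij.symm _
    have h2 : (Pi.single j 1 : Fin n → F) i = 0 := Pi.single_eq_of_ne hij _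
    simp [dotProduct_add, h1, h2]

theorem norm_le_one_of_mem_orthPairs {p : (Fin n → F) × (Fin n → F)}
    (hp : p ∈ orthPairs n F) (k : Fin n) : ‖p.1 k‖ ≤ 1 ∧ ‖p.2 k‖ ≤ 1 := by
  simp only [orthPairs, Finset.mem_union, Finset.mem_image, Finset.mem_offDiag] at hp
  obtain ⟨⟨i, j⟩, ⟨-, -, hij⟩, rfl⟩ | ⟨⟨i, j⟩, ⟨-, -, hij⟩, rfl⟩ := hp
  · simp only [Pi.single_apply]
    split_ifs <;> simp
  · simp only [Pi.add_apply, Pi.sub_apply, Pi.single_apply]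
    split_ifs <;> simp_all

/-- A matrix with entries of norm at most `R`, one of them attaining `R`, whose determinant is
smaller than `R ^ n`, is far from scalar. -/
theorem exists_orthPairs_le_norm [IsUltrametricDist F] {g : Matrix (Fin n) (Fin n) F} {R : ℝ}
    (hR : 0 < R) (hle : ∀ i j, ‖g i j‖ ≤ R) (hge : ∃ i j, R ≤ ‖g i j‖)
    (hdet : ‖g.det‖ < R ^ n) :
    ∃ p ∈ orthPairs n F, R ≤ ‖p.2 ⬝ᵥ (g *ᵥ p.1)‖ := by
  by_contra! hlt
  have hoff : ∀ i j, i ≠ j → ‖g i j‖ < R := fun i j hij => by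
    have := hlt (Pi.single j 1, Pi.single i 1) (by
      simp only [orthPairs, Finset.mem_union, Finset.mem_image, Finset.mem_offDiag]
      exact .inl ⟨(i, j), by simpa using hij, rfl⟩)
    simpa using this
  have hdiag : ∀ i j, i ≠ j → ‖g i i - g j j‖ < R := fun i j hij => by
    have h := hlt (Pi.single i 1 + Pi.single j 1, Pi.single i 1 - Pi.single j 1) (by
      simp only [orthPairs, Finset.mem_union, Finset.mem_image, Finset.mem_offDiag]
      exact .inr ⟨(i, j), by simpa using hij, rfl⟩)
    have hL : (Pi.single i 1 - Pi.single j 1) ⬝ᵥ (g *ᵥ (Pi.single i 1 + Pi.single j 1)) =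
        (g i i - g j j) + (g i j - g j i) := by
      simp [mulVec_add, sub_dotProduct]
      ring
    rw [hL] at h
    have h2 : ‖g i j - g j i‖ < R := by
      rw [sub_eq_add_neg]
      refine (IsUltrametricDist.norm_add_le_max _ _).trans_lt (max_lt (hoff i j hij) ?_)
      rw [norm_neg]
      exact hoff j i hij.symm
    rw [← add_sub_cancel_right (g i i - g j j) (g i j - g j i), sub_eq_add_neg]
    exact (IsUltrametricDist.norm_add_le_max _ _).trans_lt (max_lt h (by rwa [norm_neg]))
  obtain ⟨i, j, hij⟩ := hge
  obtain rfl : i = j := by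
    by_contra h
    exact (hoff i j h).not_ge hij
  have hi := le_antisymm (hle i i) hij
  refine hdet.ne (norm_det_eq_pow_of_offDiag_lt hR (fun k => ?_) hoff)
  by_cases hk : k = i
  · rw [hk, hi]
  · have h := hdiag k i hk
    have h2 := IsUltrametricDist.norm_add_eq_max_of_norm_ne_norm (x := g k k - g i i)
      (y := g i i) (by rw [hi]; exact h.ne)
    rwa [sub_add_cancel, hi, max_eq_right h.le] at h2

end OrthogonalPairs

section FiberIntegral

variable {F : Type*} [NontriviallyNormedField F] [ProperSpace F] [IsUltrametricDist F]
  {n : ℕ} {ϖ : F}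

omit [ProperSpace F] in
theorem continuousAt_of_Kcong_invariant (hϖ0 : 0 < ‖ϖ‖) {k : ℤ}
    {φ : Matrix (Fin n) (Fin n) F → ℂ} {g : Matrix (Fin n) (Fin n) F} (hg : g.det ≠ 0)
    (hφ : ∀ u ∈ Kcong n ϖ k, φ (g * u) = φ g) : ContinuousAt φ g := by
  have hopen : IsOpen {h : Matrix (Fin n) (Fin n) F | g⁻¹ * h ∈ Kcong n ϖ k} :=
    (isOpen_Kcong hϖ0 k).preimage (by fun_prop : Continuous fun h => g⁻¹ * h)
  have hmem : {h : Matrix (Fin n) (Fin n) F | g⁻¹ * h ∈ Kcong n ϖ k} ∈ nhds g :=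
    hopen.mem_nhds (by
      change g⁻¹ * g ∈ Kcong n ϖ k
      rw [nonsing_inv_mul _ hg.isUnit]
      exact one_mem_Kcong hϖ0 k)
  refine (continuousAt_const (y := φ g)).congr ?_
  filter_upwards [hmem] with h hh
  rw [← hφ _ hh, mul_nonsing_inv_cancel_left _ _ hg.isUnit]

variable [MeasurableSpace F] [BorelSpace F]
  [MeasurableSpace (Matrix (Fin n) (Fin n) F)] [BorelSpace (Matrix (Fin n) (Fin n) F)]

omit [MeasurableSpace F] [BorelSpace F] in
theorem integrableOn_MnP_inter_fiber (hϖ0 : 0 < ‖ϖ‖) {ψ : F → ℂ} (hψc : Continuous ψ)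
    (ν : Measure (Matrix (Fin n) (Fin n) F)) [IsFiniteMeasureOnCompacts ν]
    {φ : Matrix (Fin n) (Fin n) F → ℂ} {n₀ : ℤ}
    (hφ : ∀ g : Matrix (Fin n) (Fin n) F, g.det ≠ 0 → ∀ u ∈ Kcong n ϖ n₀, φ (g * u) = φ g)
    {x : F} (hx : x ≠ 0) (k : ℤ) :
    IntegrableOn (fun g => ψ g.trace * φ g) (MnP n ϖ k ∩ {g | g.det = x}) ν := by
  have hcl : IsClosed {g : Matrix (Fin n) (Fin n) F | g.det = x} :=
    isClosed_eq (by fun_prop) continuous_const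
  refine ContinuousOn.integrableOn_compact ((isCompact_MnP k).inter_right hcl) ?_
  rintro g ⟨-, rfl⟩
  have hg0 : g.det ≠ 0 := hx
  exact ((hψc.comp (by fun_prop : Continuous fun g : Matrix (Fin n) (Fin n) F =>
    g.trace)).continuousAt.mul
      (continuousAt_of_Kcong_invariant hϖ0 hg0 (hφ g hg0))).continuousWithinAt

theorem setIntegral_shell_eq_zero (hϖ0 : 0 < ‖ϖ‖) (hϖ1 : ‖ϖ‖ < 1)
    (hdisc : ∀ x : F, x ≠ 0 → ∃ k : ℤ, ‖x‖ = ‖ϖ‖ ^ k)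
    {ψ : F → ℂ} (hψc : Continuous ψ) (hψadd : ∀ x y : F, ψ (x + y) = ψ x * ψ y)
    (hψ0 : ψ 0 = 1) (hψnontriv : ∃ x : F, ‖x‖ ≤ ‖ϖ‖⁻¹ ∧ ψ x ≠ 1)
    (ν : Measure (Matrix (Fin n) (Fin n) F)) [SFinite ν] [IsFiniteMeasureOnCompacts ν]
    (hν : ∀ s : Matrix (Fin n) (Fin n) F, s.det = 1 → ν.map (fun h => s * h) = ν)
    {φ : Matrix (Fin n) (Fin n) F → ℂ} {n₀ : ℤ}
    (hφl : ∀ g : Matrix (Fin n) (Fin n) F, g.det ≠ 0 → ∀ u ∈ Kcong n ϖ n₀, φ (u * g) = φ g)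
    (hφr : ∀ g : Matrix (Fin n) (Fin n) F, g.det ≠ 0 → ∀ u ∈ Kcong n ϖ n₀, φ (g * u) = φ g)
    {x : F} (hx : x ≠ 0) {l : ℤ} (hl : 1 ≤ l) (hln₀ : n₀ ≤ l) (hxl : ‖x‖ < ‖ϖ‖ ^ (-l - 1)) :
    ∫ g in (MnP n ϖ (-l - 1) \ MnP n ϖ (-l)) ∩ {g | g.det = x}, ψ g.trace * φ g ∂ν = 0 := by
  classical
  set R : ℝ := ‖ϖ‖ ^ (-l - 1) with hRdef
  have hR : 0 < R := zpow_pos hϖ0 _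
  have hinvR : ‖ϖ‖⁻¹ < R := by
    rw [← _root_.zpow_neg_one]
    exact zpow_lt_zpow_right_of_lt_one₀ hϖ0 hϖ1 (by lia)
  have hR1 : 1 ≤ R := (one_le_inv_iff₀.2 ⟨hϖ0, hϖ1.le⟩).trans hinvR.le
  have hρR : ‖ϖ‖⁻¹ = ‖ϖ‖ ^ l * R := by
    rw [hRdef, ← zpow_add₀ hϖ0.ne', ← _root_.zpow_neg_one]
    congr 1
    ring
  set W : Set (Matrix (Fin n) (Fin n) F) :=
    (MnP n ϖ (-l - 1) \ MnP n ϖ (-l)) ∩ {g | g.det = x} with hW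
  set f : Matrix (Fin n) (Fin n) F → ℂ := fun g => ψ g.trace * φ g with hf
  let A : (Fin n → F) × (Fin n → F) → Set (Matrix (Fin n) (Fin n) F) :=
    fun p => {g | R ≤ ‖p.2 ⬝ᵥ (g *ᵥ p.1)‖}
  let U : Finset ((Fin n → F) × (Fin n → F)) → Set (Matrix (Fin n) (Fin n) F) :=
    fun T => ⋃ p ∈ T, A p
  have hAm : ∀ p, MeasurableSet (A p) := fun p =>
    (isClosed_le continuous_const (continuous_dotProduct_mulVec p.1 p.2).norm).measurableSet
  have hUm : ∀ T, MeasurableSet (U T) := fun T => Finset.measurableSet_biUnion T fun p _ => hAm p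
  have hWm : MeasurableSet W :=
    ((isCompact_MnP _).measurableSet.diff (isCompact_MnP _).measurableSet).inter
      (isClosed_eq (by fun_prop) continuous_const).measurableSet
  have hfi : IntegrableOn f W ν :=
    (integrableOn_MnP_inter_fiber hϖ0 hψc ν hφr hx (-l - 1)).mono_set
      (Set.inter_subset_inter_left _ Set.sdiff_subset)
  have hpert : ∀ p ∈ orthPairs n F, ∀ s : F, ‖s‖ ≤ ‖ϖ‖ ^ l →
      s • vecMulVec p.1 p.2 ∈ MnP n ϖ l := fun p hp s hs i j => by
    have h1 := norm_le_one_of_mem_orthPairs hp i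
    have h2 := norm_le_one_of_mem_orthPairs hp j
    rw [Matrix.smul_apply, vecMulVec_apply, norm_smul, norm_mul]
    calc ‖s‖ * (‖p.1 i‖ * ‖p.2 j‖) ≤ ‖s‖ * (1 * 1) := by
          gcongr
          exacts [h1.1, h2.2]
      _ ≤ ‖ϖ‖ ^ l := by simpa using hs
  have hWU : ∀ p ∈ orthPairs n F, ∀ s : F, ‖s‖ ≤ ‖ϖ‖ ^ l → ∀ g ∈ W,
      unip p.1 p.2 s * g ∈ W ∧
        ∀ p' ∈ orthPairs n F, unip p.1 p.2 s * g ∈ A p' → g ∈ A p' := by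
    rintro p hp s hs g ⟨⟨hg1, hg2⟩, hgx⟩
    have hD : s • vecMulVec p.1 p.2 * g ∈ MnP n ϖ (-1) := by
      have := mul_mem_MnP hϖ0 (hpert p hp s hs) hg1
      rwa [show l + (-l - 1) = -1 by ring] at this
    have hDl := MnP_subset_MnP hϖ0 hϖ1 (show -l ≤ -1 by lia) hD
    have hDl' := MnP_subset_MnP hϖ0 hϖ1 (show -l - 1 ≤ -1 by lia) hD
    refine ⟨⟨⟨?_, ?_⟩, ?_⟩, fun p' hp' h => ?_⟩
    · rw [unip_mul, add_mem_MnP_iff hDl']; exact hg1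
    · rw [unip_mul, add_mem_MnP_iff hDl]; exact hg2
    · change det _ = x
      rw [det_mul, det_unip (dotProduct_eq_zero_of_mem_orthPairs hp), one_mul]
      exact hgx
    · have h1 := norm_dotProduct_mulVec_le (v := p'.1) (w := p'.2)
        (zpow_nonneg hϖ0.le (-1)) (fun i => (norm_le_one_of_mem_orthPairs hp' i).1)
        (fun i => (norm_le_one_of_mem_orthPairs hp' i).2) hD
      rw [_root_.zpow_neg_one] at h1
      by_contra hlt
      have h2 : R ≤ ‖p'.2 ⬝ᵥ ((unip p.1 p.2 s * g) *ᵥ p'.1)‖ := h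
      rw [unip_mul, add_mulVec, dotProduct_add] at h2
      exact (h2.trans (IsUltrametricDist.norm_add_le_max _ _)).not_gt
        (max_lt (not_le.1 hlt) (h1.trans_lt hinvR))
  have hzero : ∀ T ⊆ orthPairs n F, ∫ g in W ∩ U T, f g ∂ν = 0 := by
    intro T
    induction T using Finset.induction_on with
    | empty => simp [U]
    | insert p T _ ih =>
      intro hT
      have hp : p ∈ orthPairs n F := hT (Finset.mem_insert_self p T)
      have hT' : T ⊆ orthPairs n F := (Finset.subset_insert p T).trans hT
      have hsplit : W ∩ U (insert p T) = W ∩ U T ∪ (W ∩ A p) \ U T := by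
        simp only [U, Finset.set_biUnion_insert]
        ext g
        simp only [Set.mem_inter_iff, Set.mem_union, Set.mem_sdiff]
        tauto
      have hSm : MeasurableSet ((W ∩ A p) \ U T) := (hWm.inter (hAm p)).diff (hUm T)
      have hSW : (W ∩ A p) \ U T ⊆ W := Set.sdiff_subset.trans Set.inter_subset_left
      rw [hsplit, setIntegral_union (Set.disjoint_left.2 fun g h h' => h'.2 h.2) hSm
        (hfi.mono_set Set.inter_subset_left) (hfi.mono_set hSW), ih hT', zero_add,
        ← integral_indicator hSm]
      have hvw := dotProduct_eq_zero_of_mem_orthPairs hp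
      refine integral_indicator_eq_zero_of_unip hψc hψadd hψ0 hR (zpow_pos hϖ0 l) hρR.le
        hψnontriv ν hν hvw ((integrable_indicator_iff hSm).2 (hfi.mono_set hSW)) ?_ ?_
        fun g hg => hg.1.2
      · rintro s hs g ⟨⟨hgW, hgA⟩, hgU⟩
        obtain ⟨h1, h2⟩ := hWU p hp s hs g hgW
        refine ⟨⟨h1, ?_⟩, fun h => hgU ?_⟩
        · change R ≤ ‖_‖
          rw [dotProduct_unip_mul_mulVec hvw]
          exact hgA
        · simp only [U, Set.mem_iUnion] at h ⊢
          obtain ⟨p', hp', h⟩ := h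
          exact ⟨p', hp', h2 p' (hT' hp') h⟩
      · rintro s hs g ⟨⟨⟨-, hgx⟩, -⟩, -⟩
        have hg0 : g.det ≠ 0 := by rw [show g.det = x from hgx]; exact hx
        have hu : unip p.1 p.2 s ∈ Kcong n ϖ n₀ := by
          rw [mem_Kcong_iff, unip, add_sub_cancel_left]
          exact MnP_subset_MnP hϖ0 hϖ1 hln₀ (hpert p hp s hs)
        simp only [hf]
        rw [trace_unip_mul, hψadd, hφl g hg0 _ hu]
        ring
  have hcover : W ⊆ U (orthPairs n F) := by
    rintro g ⟨⟨hg1, hg2⟩, hgx⟩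
    have hex : ∃ i j, R ≤ ‖g i j‖ := by
      by_contra! h
      refine hg2 fun i j => ?_
      by_contra! h'
      exact (h i j).not_ge (zpow_pred_le_norm_of_zpow_lt hϖ0 hϖ1 hdisc h')
    obtain ⟨p, hp, hpg⟩ := exists_orthPairs_le_norm hR hg1 hex (by
      rw [show g.det = x from hgx]
      obtain ⟨i, -⟩ := hex
      exact hxl.trans_le (le_self_pow₀ hR1 (Fin.pos i).ne'))
    simp only [U, Set.mem_iUnion]
    exact ⟨p, hp, hpg⟩
  rw [← Set.inter_eq_left.2 hcover]
  exact hzero _ subset_rfl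

end FiberIntegral

section Convolution

variable {F : Type*} [NontriviallyNormedField F] [ProperSpace F] [IsUltrametricDist F]
  {n : ℕ} {ϖ : F}
  [MeasurableSpace (Matrix (Fin n) (Fin n) F)] [BorelSpace (Matrix (Fin n) (Fin n) F)]
  (μ : Measure (Matrix (Fin n) (Fin n) F)) [μ.IsAddHaarMeasure]

omit [BorelSpace (Matrix (Fin n) (Fin n) F)] in
theorem measure_MnP_zero_ne (ϖ : F) : μ (MnP n ϖ 0) ≠ 0 ∧ μ (MnP n ϖ 0) ≠ ⊤ := by
  have h1 : MnP n ϖ 0 = MnP n (1 : F) 0 := by simp [MnP]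
  rw [h1]
  refine ⟨((isOpen_MnP (by simp) 0).measure_pos μ ⟨0, fun i j => by simp⟩).ne',
    (isCompact_MnP 0).measure_lt_top.ne⟩

omit [BorelSpace (Matrix (Fin n) (Fin n) F)] in
theorem nnreal_smul_measure_injective {a b : NNReal} (h : a • μ = b • μ) : a = b := by
  have h1 := congrArg (fun m => m (MnP n (1 : F) 0)) h
  simp only [Measure.smul_apply, ENNReal.smul_def, smul_eq_mul] at h1
  have := measure_MnP_zero_ne μ (1 : F)
  exact_mod_cast (ENNReal.mul_left_inj this.1 this.2).1 h1

omit [ProperSpace F] [MeasurableSpace (Matrix (Fin n) (Fin n) F)]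
  [BorelSpace (Matrix (Fin n) (Fin n) F)] in
theorem mul_mem_MnP_zero_iff (hϖ0 : 0 < ‖ϖ‖) (hϖ1 : ‖ϖ‖ < 1) {l : ℤ} (hl : 1 ≤ l)
    {u : Matrix (Fin n) (Fin n) F} (hu : u ∈ Kcong n ϖ l) (g : Matrix (Fin n) (Fin n) F) :
    u * g ∈ MnP n ϖ 0 ↔ g ∈ MnP n ϖ 0 := by
  have hu' : u - 1 ∈ MnP n ϖ 1 := MnP_subset_MnP hϖ0 hϖ1 hl hu
  have hug : u * g = g + (u - 1) * g := by rw [sub_mul, one_mul, add_sub_cancel]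
  rw [hug]
  constructor
  · intro h
    by_contra hg
    obtain ⟨i, j, hij⟩ : ∃ i j, 1 < ‖g i j‖ := by simpa [MnP] using hg
    obtain ⟨⟨a, b⟩, hab⟩ :=
      haveI : Nonempty (Fin n × Fin n) := ⟨(i, j)⟩
      Finite.exists_max fun p : Fin n × Fin n => ‖g p.1 p.2‖
    have hab1 : 1 < ‖g a b‖ := hij.trans_le (hab (i, j))
    have hsmall : ‖((u - 1) * g) a b‖ < ‖g a b‖ := by
      refine (norm_mul_apply_le_of_le (norm_nonneg (g a b)) (zpow_nonneg hϖ0.le 1) hu'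
        (fun i j => hab (i, j)) a b).trans_lt ?_
      rw [_root_.zpow_one]
      exact mul_lt_of_lt_one_left (one_pos.trans hab1) hϖ1
    have := h a b
    rw [Matrix.add_apply, IsUltrametricDist.norm_add_eq_max_of_norm_ne_norm hsmall.ne',
      max_eq_left hsmall.le, _root_.zpow_zero] at this
    exact this.not_gt hab1
  · intro h
    refine add_mem_MnP h (MnP_subset_MnP hϖ0 hϖ1 (show (0 : ℤ) ≤ 1 + 0 by lia)
      (mul_mem_MnP hϖ0 hu' h))

theorem map_mul_left_of_mem_Kcong (hϖ0 : 0 < ‖ϖ‖) (hϖ1 : ‖ϖ‖ < 1) {l : ℤ} (hl : 1 ≤ l)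
    {u : Matrix (Fin n) (Fin n) F} (hu : u ∈ Kcong n ϖ l) : μ.map (fun h => u * h) = μ := by
  have hdet : u.det ≠ 0 := norm_pos_iff.1 (by rw [norm_det_of_mem_Kcong hϖ0 hϖ1 hl hu]; simp)
  obtain ⟨c, -, hc⟩ := exists_map_mul_left_eq_smul μ hdet
  have h1 := congrArg (fun m => m (MnP n ϖ 0)) hc
  have hpre : (fun h => u * h) ⁻¹' MnP n ϖ 0 = MnP n ϖ 0 :=
    Set.ext fun g => mul_mem_MnP_zero_iff hϖ0 hϖ1 hl hu g
  simp only [(measurableEmbedding_mul_left hdet).map_apply, hpre, Measure.smul_apply,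
    ENNReal.smul_def, smul_eq_mul] at h1
  have hne := measure_MnP_zero_ne μ ϖ
  have : c = 1 := by
    have h2 : (1 : ENNReal) * μ (MnP n ϖ 0) = c * μ (MnP n ϖ 0) := by rw [one_mul, ← h1]
    exact_mod_cast ((ENNReal.mul_left_inj hne.1 hne.2).1 h2).symm
  rw [hc, this, one_smul]

omit [ProperSpace F] [μ.IsAddHaarMeasure] in
theorem muGL_Kcong (hϖ0 : 0 < ‖ϖ‖) (hϖ1 : ‖ϖ‖ < 1) {l : ℤ} (hl : 1 ≤ l) :
    muGL n μ (Kcong n ϖ l) = μ (Kcong n ϖ l) := by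
  have hm : MeasurableSet (Kcong n ϖ l) := (isOpen_Kcong hϖ0 l).measurableSet
  rw [muGL, withDensity_apply _ hm, ← setLIntegral_one]
  refine setLIntegral_congr_fun hm fun g hg => ?_
  simp [norm_det_of_mem_Kcong hϖ0 hϖ1 hl hg]

omit [IsUltrametricDist F] [MeasurableSpace (Matrix (Fin n) (Fin n) F)]
  [BorelSpace (Matrix (Fin n) (Fin n) F)] in
theorem isCompact_Kcong (l : ℤ) : IsCompact (Kcong n ϖ l) := by
  have : Kcong n ϖ l = (fun g => g + 1) '' MnP n ϖ l := by
    ext g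
    rw [mem_Kcong_iff]
    exact ⟨fun h => ⟨g - 1, h, sub_add_cancel g 1⟩, by rintro ⟨h, hh, rfl⟩; simpa using hh⟩
  rw [this]
  exact (isCompact_MnP l).image (by fun_prop)

omit [ProperSpace F] in
theorem integral_Kcong_trace (hϖ0 : 0 < ‖ϖ‖) (hϖ1 : ‖ϖ‖ < 1)
    (hdisc : ∀ x : F, x ≠ 0 → ∃ k : ℤ, ‖x‖ = ‖ϖ‖ ^ k)
    {ψ : F → ℂ} (hψadd : ∀ x y : F, ψ (x + y) = ψ x * ψ y)
    (hψtriv : ∀ x : F, ‖x‖ ≤ 1 → ψ x = 1) (hψnontriv : ∃ x : F, ‖x‖ ≤ ‖ϖ‖⁻¹ ∧ ψ x ≠ 1)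
    (l : ℤ) (g : Matrix (Fin n) (Fin n) F) :
    ∫ k, (Kcong n ϖ l).indicator (fun k => ψ (g * k).trace) k ∂μ =
      (MnP n ϖ (-l)).indicator (fun g => ψ g.trace) g * (μ (Kcong n ϖ l)).toReal := by
  by_cases hg : g ∈ MnP n ϖ (-l)
  · have hm : MeasurableSet (Kcong n ϖ l) := (isOpen_Kcong hϖ0 l).measurableSet
    have hcongr : Set.EqOn (fun k => ψ (g * k).trace) (fun _ => ψ g.trace) (Kcong n ϖ l) := by
      intro k hk
      have h0 : g * (k - 1) ∈ MnP n ϖ 0 := by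
        simpa using mul_mem_MnP hϖ0 hg (mem_Kcong_iff.1 hk)
      have h1 : ψ (g * (k - 1)).trace = 1 := hψtriv _ (by
        simpa using norm_trace_le_of_le (zpow_nonneg hϖ0.le 0) h0)
      simp only
      rw [show g * k = g + g * (k - 1) by rw [mul_sub, mul_one, add_sub_cancel], trace_add, hψadd,
        h1, mul_one]
    rw [integral_indicator hm, setIntegral_congr_fun hm hcongr, setIntegral_const,
      Set.indicator_of_mem hg, Complex.real_smul, mul_comm]
    rfl
  · rw [Set.indicator_of_notMem hg, zero_mul]
    obtain ⟨i, j, hij⟩ : ∃ i j, ‖ϖ‖ ^ (-l) < ‖g i j‖ := by simpa [MnP] using hg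
    obtain ⟨z, hz, hz1⟩ := hψnontriv
    have h1 := zpow_pred_le_norm_of_zpow_lt hϖ0 hϖ1 hdisc hij
    have hpos : 0 < ‖g i j‖ := (zpow_pos hϖ0 _).trans hij
    have ht : ‖z / g i j‖ ≤ ‖ϖ‖ ^ l := by
      rw [norm_div, div_le_iff₀ hpos]
      calc ‖z‖ ≤ ‖ϖ‖⁻¹ := hz
        _ = ‖ϖ‖ ^ l * ‖ϖ‖ ^ (-l - 1) := by
          rw [← zpow_add₀ hϖ0.ne', ← _root_.zpow_neg_one]
          congr 1
          ring
        _ ≤ ‖ϖ‖ ^ l * ‖g i j‖ := by gcongr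
    have hmem : Matrix.single j i (z / g i j) ∈ MnP n ϖ l := fun a b => by
      rw [Matrix.single_apply]
      split_ifs
      · exact ht
      · simpa using zpow_nonneg hϖ0.le l
    refine integral_indicator_eq_zero_of_add_left μ (a₀ := Matrix.single j i (z / g i j)) hz1
      (fun k => ?_) fun k _ => ?_
    · rw [mem_Kcong_iff, mem_Kcong_iff, add_comm, add_sub_right_comm, add_mem_MnP_iff hmem]
    · rw [mul_add, trace_add, hψadd, trace_mul_single]
      congr 2
      simp only [MulOpposite.smul_eq_mul_unop, MulOpposite.unop_op]
      exact mul_div_cancel₀ _ (norm_pos_iff.1 hpos)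

theorem convGJ_cFun (hϖ0 : 0 < ‖ϖ‖) (hϖ1 : ‖ϖ‖ < 1)
    (hdisc : ∀ x : F, x ≠ 0 → ∃ k : ℤ, ‖x‖ = ‖ϖ‖ ^ k)
    {ψ : F → ℂ} (hψadd : ∀ x y : F, ψ (x + y) = ψ x * ψ y)
    (hψtriv : ∀ x : F, ‖x‖ ≤ 1 → ψ x = 1) (hψnontriv : ∃ x : F, ‖x‖ ≤ ‖ϖ‖⁻¹ ∧ ψ x ≠ 1)
    {l : ℤ} (hl : 1 ≤ l) {g : Matrix (Fin n) (Fin n) F} (hg : g.det ≠ 0)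
    {c : NNReal} (hc0 : c ≠ 0) (hc : μ.map (fun h => g * h) = c • μ) :
    convGJ n μ ψ (cFun n μ ϖ l) g =
      (MnP n ϖ (-l)).indicator (fun g => ψ g.trace) g *
        (((c : ℝ)⁻¹ * (‖g.det‖ ^ ((n : ℝ) / 2) * (‖g.det‖ ^ n)⁻¹) : ℝ) : ℂ) := by
  set V : ℝ := (μ (Kcong n ϖ l)).toReal with hV
  have hV0 : (V : ℂ) ≠ 0 := by
    rw [hV, Complex.ofReal_ne_zero, ENNReal.toReal_ne_zero]
    exact ⟨((isOpen_Kcong hϖ0 l).measure_pos μ ⟨1, one_mem_Kcong hϖ0 l⟩).ne',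
      (isCompact_Kcong l).measure_lt_top.ne⟩
  let H : Matrix (Fin n) (Fin n) F → ℂ := fun h =>
    (‖h.det‖ ^ n)⁻¹ • (PhiGJ n ψ h * cFun n μ ϖ l (g⁻¹ * h))
  have hconv : convGJ n μ ψ (cFun n μ ϖ l) g = ∫ h, H h ∂μ := by
    have hmeas : Measurable fun g : Matrix (Fin n) (Fin n) F =>
        ENNReal.ofReal ((‖g.det‖ ^ n)⁻¹) :=
      ENNReal.measurable_ofReal.comp
        ((by fun_prop : Continuous fun g : Matrix (Fin n) (Fin n) F =>
          ‖g.det‖ ^ n).measurable.inv)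
    rw [convGJ, muGL, integral_withDensity_eq_integral_toReal_smul hmeas
      (.of_forall fun _ => ENNReal.ofReal_lt_top)]
    congr 1 with h
    rw [ENNReal.toReal_ofReal (by positivity)]
  have hsub : (c : ℝ) • ∫ h, H h ∂μ = ∫ k, H (g * k) ∂μ := by
    rw [← (measurableEmbedding_mul_left hg).integral_map, hc, integral_smul_nnreal_measure]
    rfl
  have hHg : ∀ k, H (g * k) = (((‖g.det‖ ^ ((n : ℝ) / 2) * (‖g.det‖ ^ n)⁻¹) : ℝ) : ℂ) *
      (V : ℂ)⁻¹ * (Kcong n ϖ l).indicator (fun k => ψ (g * k).trace) k := fun k => by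
    simp only [H, cFun, muGL_Kcong μ hϖ0 hϖ1 hl, ← hV,
      nonsing_inv_mul_cancel_left _ _ hg.isUnit]
    by_cases hk : k ∈ Kcong n ϖ l
    · rw [Set.indicator_of_mem hk, Set.indicator_of_mem hk, PhiGJ, det_mul, norm_mul,
        norm_det_of_mem_Kcong hϖ0 hϖ1 hl hk, mul_one, Complex.real_smul]
      push_cast
      ring
    · rw [Set.indicator_of_notMem hk, Set.indicator_of_notMem hk]
      simp
  simp only [hHg, integral_const_mul,
    integral_Kcong_trace μ hϖ0 hϖ1 hdisc hψadd hψtriv hψnontriv] at hsub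
  rw [← hconv, ← hV, Complex.real_smul] at hsub
  have hc0' : ((c : ℝ) : ℂ) ≠ 0 := by exact_mod_cast hc0
  rw [← mul_right_inj' hc0', hsub]
  push_cast
  field_simp

end Convolution

section FiberMeasure

variable {F : Type*} [NontriviallyNormedField F] {n : ℕ}
  [MeasurableSpace (Matrix (Fin n) (Fin n) F)] [BorelSpace (Matrix (Fin n) (Fin n) F)]

theorem map_map_mul_left (μ : Measure (Matrix (Fin n) (Fin n) F))
    (a b : Matrix (Fin n) (Fin n) F) :
    (μ.map fun h => b * h).map (fun h => a * h) = μ.map fun h => a * b * h := by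
  have hmeas : ∀ a : Matrix (Fin n) (Fin n) F, Measurable fun h => a * h := fun a =>
    (by fun_prop : Continuous fun h => a * h).measurable
  rw [Measure.map_map (hmeas a) (hmeas b)]
  congr 1 with h : 1
  exact (Matrix.mul_assoc a b h).symm

theorem isFiniteMeasureOnCompacts_map_mul_left (μ : Measure (Matrix (Fin n) (Fin n) F))
    [IsFiniteMeasureOnCompacts μ] {a : Matrix (Fin n) (Fin n) F} (ha : a.det ≠ 0) :
    IsFiniteMeasureOnCompacts (μ.map fun h => a * h) :=
  Measure.IsFiniteMeasureOnCompacts.map μ (mulLeftEquiv a ha).toHomeomorph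

theorem map_mul_left_map_mul_left_of_det_eq_one {μ : Measure (Matrix (Fin n) (Fin n) F)}
    (hμ : ∀ s : Matrix (Fin n) (Fin n) F, s.det = 1 → μ.map (fun h => s * h) = μ)
    {a : Matrix (Fin n) (Fin n) F} (ha : a.det ≠ 0) {s : Matrix (Fin n) (Fin n) F}
    (hs : s.det = 1) :
    (μ.map fun h => a * h).map (fun h => s * h) = μ.map fun h => a * h := by
  have hconj : (a⁻¹ * s * a).det = 1 := by
    rw [det_mul, det_mul, hs, mul_one, ← det_mul, nonsing_inv_mul _ ha.isUnit, det_one]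
  rw [map_map_mul_left]
  conv_rhs => rw [← hμ _ hconj, map_map_mul_left]
  rw [Matrix.mul_assoc a⁻¹, mul_nonsing_inv_cancel_left _ _ ha.isUnit]

end FiberMeasure

section Stability

variable {F : Type*} [NontriviallyNormedField F] [ProperSpace F] [IsUltrametricDist F]
  {n : ℕ} {ϖ : F}
  [MeasurableSpace (Matrix (Fin n) (Fin n) F)] [BorelSpace (Matrix (Fin n) (Fin n) F)]

theorem exists_convGJ_cFun_mul_eq_indicator (μ : Measure (Matrix (Fin n) (Fin n) F))
    [μ.IsAddHaarMeasure] (hϖ0 : 0 < ‖ϖ‖) (hϖ1 : ‖ϖ‖ < 1)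
    (hdisc : ∀ x : F, x ≠ 0 → ∃ k : ℤ, ‖x‖ = ‖ϖ‖ ^ k)
    {ψ : F → ℂ} (hψadd : ∀ x y : F, ψ (x + y) = ψ x * ψ y)
    (hψtriv : ∀ x : F, ‖x‖ ≤ 1 → ψ x = 1) (hψnontriv : ∃ x : F, ‖x‖ ≤ ‖ϖ‖⁻¹ ∧ ψ x ≠ 1)
    {φ : Matrix (Fin n) (Fin n) F → ℂ} {n₀ : ℤ} (hn₀ : 1 ≤ n₀)
    (hφ : ∀ g : Matrix (Fin n) (Fin n) F,
      ∀ k₁ ∈ Kcong n ϖ n₀, ∀ k₂ ∈ Kcong n ϖ n₀, φ (k₁ * g * k₂) = φ g) :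
    ∃ φ' : Matrix (Fin n) (Fin n) F → ℂ,
      (∀ g : Matrix (Fin n) (Fin n) F, g.det ≠ 0 → ∀ u ∈ Kcong n ϖ n₀, φ' (u * g) = φ' g) ∧
      (∀ g : Matrix (Fin n) (Fin n) F, g.det ≠ 0 → ∀ u ∈ Kcong n ϖ n₀, φ' (g * u) = φ' g) ∧
      ∀ l : ℤ, 1 ≤ l → ∀ g : Matrix (Fin n) (Fin n) F, g.det ≠ 0 →
        convGJ n μ ψ (cFun n μ ϖ l) g * φ g =
          (MnP n ϖ (-l)).indicator (fun g => ψ g.trace * φ' g) g := by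
  have hex : ∀ g : Matrix (Fin n) (Fin n) F, ∃ c : NNReal,
      g.det ≠ 0 → c ≠ 0 ∧ μ.map (fun h => g * h) = c • μ := fun g => by
    by_cases hg : g.det = 0
    · exact ⟨0, fun h => (h hg).elim⟩
    · obtain ⟨c, hc⟩ := exists_map_mul_left_eq_smul μ hg
      exact ⟨c, fun _ => hc⟩
  choose c hc using hex
  have hdet : ∀ u ∈ Kcong n ϖ n₀, ‖u.det‖ = 1 := fun u hu =>
    norm_det_of_mem_Kcong hϖ0 hϖ1 hn₀ hu
  have hdet0 : ∀ u ∈ Kcong n ϖ n₀, u.det ≠ 0 := fun u hu => norm_ne_zero_iff.1 (by simp [hdet u hu])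
  have hu1 := fun {u} hu => map_mul_left_of_mem_Kcong (u := u) μ hϖ0 hϖ1 hn₀ hu
  have hcl : ∀ g : Matrix (Fin n) (Fin n) F, g.det ≠ 0 → ∀ u ∈ Kcong n ϖ n₀,
      c (u * g) = c g := fun g hg u hu => by
    refine nnreal_smul_measure_injective μ ?_
    rw [← (hc (u * g) (by rw [det_mul]; exact mul_ne_zero (hdet0 u hu) hg)).2,
      ← map_map_mul_left, (hc g hg).2, Measure.map_smul, hu1 hu]
  have hcr : ∀ g : Matrix (Fin n) (Fin n) F, g.det ≠ 0 → ∀ u ∈ Kcong n ϖ n₀,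
      c (g * u) = c g := fun g hg u hu => by
    refine nnreal_smul_measure_injective μ ?_
    rw [← (hc (g * u) (by rw [det_mul]; exact mul_ne_zero hg (hdet0 u hu))).2,
      ← map_map_mul_left, hu1 hu, (hc g hg).2]
  have h1 : (1 : Matrix (Fin n) (Fin n) F) ∈ Kcong n ϖ n₀ := one_mem_Kcong hϖ0 n₀
  refine ⟨fun g => (((c g : ℝ)⁻¹ * (‖g.det‖ ^ ((n : ℝ) / 2) * (‖g.det‖ ^ n)⁻¹) : ℝ) : ℂ) * φ g,
    fun g hg u hu => ?_, fun g hg u hu => ?_, fun l hl g hg => ?_⟩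
  · have hφu : φ (u * g) = φ g := by simpa using hφ g u hu 1 h1
    simp only [hcl g hg u hu, det_mul, norm_mul, hdet u hu, one_mul, hφu]
  · have hφu : φ (g * u) = φ g := by simpa using hφ g 1 h1 u hu
    simp only [hcr g hg u hu, det_mul, norm_mul, hdet u hu, mul_one, hφu]
  · rw [convGJ_cFun μ hϖ0 hϖ1 hdisc hψadd hψtriv hψnontriv hl hg (hc g hg).1 (hc g hg).2]
    by_cases hgl : g ∈ MnP n ϖ (-l)
    · rw [Set.indicator_of_mem hgl, Set.indicator_of_mem hgl, mul_assoc]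
    · rw [Set.indicator_of_notMem hgl, Set.indicator_of_notMem hgl, zero_mul, zero_mul]

variable [MeasurableSpace F] [BorelSpace F]

theorem setIntegral_MnP_inter_fiber_sub_one (hϖ0 : 0 < ‖ϖ‖) (hϖ1 : ‖ϖ‖ < 1)
    (hdisc : ∀ x : F, x ≠ 0 → ∃ k : ℤ, ‖x‖ = ‖ϖ‖ ^ k)
    {ψ : F → ℂ} (hψc : Continuous ψ) (hψadd : ∀ x y : F, ψ (x + y) = ψ x * ψ y)
    (hψ0 : ψ 0 = 1) (hψnontriv : ∃ x : F, ‖x‖ ≤ ‖ϖ‖⁻¹ ∧ ψ x ≠ 1)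
    (ν : Measure (Matrix (Fin n) (Fin n) F)) [SFinite ν] [IsFiniteMeasureOnCompacts ν]
    (hν : ∀ s : Matrix (Fin n) (Fin n) F, s.det = 1 → ν.map (fun h => s * h) = ν)
    {φ : Matrix (Fin n) (Fin n) F → ℂ} {n₀ : ℤ}
    (hφl : ∀ g : Matrix (Fin n) (Fin n) F, g.det ≠ 0 → ∀ u ∈ Kcong n ϖ n₀, φ (u * g) = φ g)
    (hφr : ∀ g : Matrix (Fin n) (Fin n) F, g.det ≠ 0 → ∀ u ∈ Kcong n ϖ n₀, φ (g * u) = φ g)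
    {x : F} (hx : x ≠ 0) {l : ℤ} (hl : 1 ≤ l) (hln₀ : n₀ ≤ l) (hxl : ‖x‖ < ‖ϖ‖ ^ (-l - 1)) :
    ∫ g in MnP n ϖ (-l - 1) ∩ {g | g.det = x}, ψ g.trace * φ g ∂ν =
      ∫ g in MnP n ϖ (-l) ∩ {g | g.det = x}, ψ g.trace * φ g ∂ν := by
  have hsub : MnP n ϖ (-l) ⊆ MnP n ϖ (-l - 1) := MnP_subset_MnP hϖ0 hϖ1 (by lia)
  have hfi := integrableOn_MnP_inter_fiber hϖ0 hψc ν hφr hx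
  have hDm : MeasurableSet {g : Matrix (Fin n) (Fin n) F | g.det = x} :=
    (isClosed_eq (by fun_prop) continuous_const).measurableSet
  have hSm : MeasurableSet ((MnP n ϖ (-l - 1) \ MnP n ϖ (-l)) ∩ {g | g.det = x}) :=
    ((isCompact_MnP _).measurableSet.diff (isCompact_MnP _).measurableSet).inter hDm
  rw [← Set.union_sdiff_cancel hsub, Set.union_inter_distrib_right,
    setIntegral_union (Set.disjoint_left.2 fun g h h' => h'.1.2 h.1) hSm (hfi (-l))
      ((hfi (-l - 1)).mono_set (Set.inter_subset_inter_left _ Set.sdiff_subset)),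
    setIntegral_shell_eq_zero hϖ0 hϖ1 hdisc hψc hψadd hψ0 hψnontriv ν hν hφl hφr hx hl hln₀ hxl,
    add_zero]

theorem setIntegral_MnP_inter_fiber_eq_of_le (hϖ0 : 0 < ‖ϖ‖) (hϖ1 : ‖ϖ‖ < 1)
    (hdisc : ∀ x : F, x ≠ 0 → ∃ k : ℤ, ‖x‖ = ‖ϖ‖ ^ k)
    {ψ : F → ℂ} (hψc : Continuous ψ) (hψadd : ∀ x y : F, ψ (x + y) = ψ x * ψ y)
    (hψ0 : ψ 0 = 1) (hψnontriv : ∃ x : F, ‖x‖ ≤ ‖ϖ‖⁻¹ ∧ ψ x ≠ 1)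
    (ν : Measure (Matrix (Fin n) (Fin n) F)) [SFinite ν] [IsFiniteMeasureOnCompacts ν]
    (hν : ∀ s : Matrix (Fin n) (Fin n) F, s.det = 1 → ν.map (fun h => s * h) = ν)
    {φ : Matrix (Fin n) (Fin n) F → ℂ} {n₀ : ℤ}
    (hφl : ∀ g : Matrix (Fin n) (Fin n) F, g.det ≠ 0 → ∀ u ∈ Kcong n ϖ n₀, φ (u * g) = φ g)
    (hφr : ∀ g : Matrix (Fin n) (Fin n) F, g.det ≠ 0 → ∀ u ∈ Kcong n ϖ n₀, φ (g * u) = φ g)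
    {x : F} (hx : x ≠ 0) {l : ℤ} (hl : 1 ≤ l) (hln₀ : n₀ ≤ l) (hxl : ‖x‖ < ‖ϖ‖ ^ (-l - 1))
    {m : ℤ} (hlm : l ≤ m) :
    ∫ g in MnP n ϖ (-m) ∩ {g | g.det = x}, ψ g.trace * φ g ∂ν =
      ∫ g in MnP n ϖ (-l) ∩ {g | g.det = x}, ψ g.trace * φ g ∂ν := by
  induction m, hlm using Int.leInduction with
  | base => rfl
  | succ m hlm ih =>
    rw [← ih, neg_add', setIntegral_MnP_inter_fiber_sub_one hϖ0 hϖ1 hdisc hψc hψadd hψ0 hψnontriv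
      ν hν hφl hφr hx (hl.trans hlm) (hln₀.trans hlm)
      (hxl.trans_le (zpow_le_zpow_right_of_le_one₀ hϖ0 hϖ1.le (by lia)))]

end Stability

section Section

variable {F : Type*} [NontriviallyNormedField F] {n : ℕ}

theorem det_t1_ne_zero {x : F} (hx : x ≠ 0) : (t1 n x).det ≠ 0 := by
  rw [t1, det_diagonal]
  refine Finset.prod_ne_zero_iff.2 fun i _ => ?_
  split_ifs
  exacts [hx, one_ne_zero]

theorem continuous_t1 : Continuous (t1 n : F → Matrix (Fin n) (Fin n) F) := by
  refine Continuous.matrix_diagonal (continuous_pi fun i => ?_)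
  split_ifs
  exacts [continuous_id, continuous_const]

end Section

/-- Let `φ : GL_n(F) → ℂ` be bi-invariant under a principal congruence
subgroup `K_{n₀}`.  Then for any open compact subset `𝔫` of `Fˣ`, there exists an integer
`ℓ_𝔫` such that for all integers `ℓ, m > ℓ_𝔫` and all `x ∈ 𝔫` the fiber integrals
`∫_{det g = x} (Φ_GJ * c_ℓ^∨)(g)·φ(g) d_xg` and `∫_{det g = x} (Φ_GJ * c_m^∨)(g)·φ(g) d_xg`
agree; i.e. the truncated fiber integrals are uniformly stable as `ℓ → ∞` for `x ∈ 𝔫`.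
Fiber integrals are computed against the pushforward of the Haar measure `μ₁` of `SL_n(F)`
under `h ↦ t₁(x)·h`. -/
theorem statement5
    {F : Type*} [NontriviallyNormedField F] [CompleteSpace F] [ProperSpace F]
    [CharZero F] [MeasurableSpace F] [BorelSpace F]
    (hna : ∀ x y : F, ‖x + y‖ ≤ max ‖x‖ ‖y‖)
    (ϖ : F) (hϖ0 : 0 < ‖ϖ‖) (hϖ1 : ‖ϖ‖ < 1)
    (hdisc : ∀ x : F, x ≠ 0 → ∃ k : ℤ, ‖x‖ = ‖ϖ‖ ^ k)
    (ψ : F → ℂ) (hψc : Continuous ψ)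
    (hψadd : ∀ x y : F, ψ (x + y) = ψ x * ψ y)
    (hψtriv : ∀ x : F, ‖x‖ ≤ 1 → ψ x = 1)
    (hψnontriv : ∃ x : F, ‖x‖ ≤ ‖ϖ‖⁻¹ ∧ ψ x ≠ 1)
    (n : ℕ)
    [MeasurableSpace (Matrix (Fin n) (Fin n) F)]
    [BorelSpace (Matrix (Fin n) (Fin n) F)]
    -- `μp` is the additive Haar measure `d⁺X` on `M_n(F)`
    (μp : Measure (Matrix (Fin n) (Fin n) F)) [μp.IsAddHaarMeasure]
    -- `μ₁` is a Haar measure of `SL_n(F)`, viewed as a measure on the matrix space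
    (μ₁ : Measure (Matrix (Fin n) (Fin n) F))
    (hμ₁supp : μ₁ {h | h.det ≠ 1} = 0)
    (hμ₁inv : ∀ s : Matrix (Fin n) (Fin n) F, s.det = 1 →
      Measure.map (fun h => s * h) μ₁ = μ₁)
    (hμ₁fin : ∀ K : Set (Matrix (Fin n) (Fin n) F), IsCompact K → μ₁ K < ⊤)
    -- `φ` is bi-invariant under the principal congruence subgroup `K_{n₀}`
    (φ : Matrix (Fin n) (Fin n) F → ℂ)
    (n₀ : ℤ) (hn₀ : 1 ≤ n₀)
    (hφinv : ∀ g : Matrix (Fin n) (Fin n) F,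
      ∀ k₁ ∈ Kcong n ϖ n₀, ∀ k₂ ∈ Kcong n ϖ n₀, φ (k₁ * g * k₂) = φ g)
    (𝔫 : Set F) (h𝔫o : IsOpen 𝔫) (h𝔫c : IsCompact 𝔫) (h𝔫0 : ∀ x ∈ 𝔫, x ≠ 0) :
    ∃ ℓ𝔫 : ℤ, ∀ ℓ m : ℤ, ℓ𝔫 < ℓ → ℓ𝔫 < m → ∀ x ∈ 𝔫,
      ∫ h, convGJ n μp ψ (cFun n μp ϖ ℓ) (t1 n x * h) * φ (t1 n x * h) ∂μ₁
        = ∫ h, convGJ n μp ψ (cFun n μp ϖ m) (t1 n x * h) * φ (t1 n x * h) ∂μ₁ := by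
  have : IsUltrametricDist F :=
    IsUltrametricDist.isUltrametricDist_of_forall_norm_add_le_max_norm hna
  have : IsFiniteMeasureOnCompacts μ₁ := ⟨fun K hK => hμ₁fin K hK⟩
  obtain ⟨φ', hφl, hφr, hconv⟩ := exists_convGJ_cFun_mul_eq_indicator μp hϖ0 hϖ1 hdisc hψadd
    hψtriv hψnontriv hn₀ hφinv
  obtain ⟨C, hC⟩ := h𝔫c.exists_bound_of_continuousOn
    (f := fun x => (t1 n x).det) continuous_t1.matrix_det.continuousOn
  obtain ⟨N, hN⟩ := pow_unbounded_of_one_lt C ((one_lt_inv₀ hϖ0).2 hϖ1)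
  set L : ℤ := max n₀ N with hL
  refine ⟨L, ?_⟩
  suffices h : ∀ x ∈ 𝔫, ∃ J : ℂ, ∀ l : ℤ, L ≤ l →
      ∫ h, convGJ n μp ψ (cFun n μp ϖ l) (t1 n x * h) * φ (t1 n x * h) ∂μ₁ = J by
    intro l m hl hm x hx
    obtain ⟨J, hJ⟩ := h x hx
    rw [hJ l hl.le, hJ m hm.le]
  intro x hx
  have hX : (t1 n x).det ≠ 0 := det_t1_ne_zero (h𝔫0 x hx)
  set ν : Measure (Matrix (Fin n) (Fin n) F) := μ₁.map fun h => t1 n x * h with hν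
  have : IsFiniteMeasureOnCompacts ν := isFiniteMeasureOnCompacts_map_mul_left μ₁ hX
  have hemb := measurableEmbedding_mul_left (n := n) hX
  have hνsupp : ∀ᵐ g ∂ν, g.det = (t1 n x).det := by
    rw [hν, hemb.ae_map_iff]
    filter_upwards [show ∀ᵐ h ∂μ₁, h.det = 1 from hμ₁supp] with h hh
    rw [det_mul, hh, mul_one]
  have hXL : ‖(t1 n x).det‖ < ‖ϖ‖ ^ (-L - 1) := by
    refine ((hC x hx).trans_lt hN).trans_le ?_
    rw [inv_pow, ← zpow_natCast, ← _root_.zpow_neg]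
    exact zpow_le_zpow_right_of_le_one₀ hϖ0 hϖ1.le (by lia)
  have hDm : MeasurableSet {g : Matrix (Fin n) (Fin n) F | g.det = (t1 n x).det} :=
    (isClosed_eq (by fun_prop) continuous_const).measurableSet
  refine ⟨∫ g in MnP n ϖ (-L) ∩ {g | g.det = (t1 n x).det}, ψ g.trace * φ' g ∂ν, fun l hl => ?_⟩
  rw [← setIntegral_MnP_inter_fiber_eq_of_le hϖ0 hϖ1 hdisc hψc hψadd (hψtriv 0 (by simp))
    hψnontriv ν (fun s hs => map_mul_left_map_mul_left_of_det_eq_one hμ₁inv hX hs) hφl hφr hX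
    (by lia) (le_max_left n₀ N) hXL hl,
    ← hemb.integral_map fun g => convGJ n μp ψ (cFun n μp ϖ l) g * φ g,
    ← integral_indicator ((isCompact_MnP _).measurableSet.inter hDm)]
  refine integral_congr_ae ?_
  filter_upwards [hνsupp] with g hg
  have hiff : g ∈ MnP n ϖ (-l) ∩ {g | g.det = (t1 n x).det} ↔ g ∈ MnP n ϖ (-l) :=
    and_iff_left hg
  rw [hconv l (by lia) g (hg ▸ hX)]
  by_cases hgl : g ∈ MnP n ϖ (-l)
  · rw [Set.indicator_of_mem hgl, Set.indicator_of_mem (hiff.2 hgl)]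
  · rw [Set.indicator_of_notMem hgl, Set.indicator_of_notMem fun h => hgl (hiff.1 h)]
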